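/- arXiv:2104.14450 — 3 statements merged into one kernel-verified Lean document; each statement's English description precedes it below -/
import Mathlib

section
/- Let n ≥ 1, λ > 0, δ ∈ (0,1). Let 𝒜, ℬ be nonempty compact metric spaces and let A : 𝒜×ℬ → (n×n real symmetric matrices), b : 𝒜×ℬ → ℝⁿ, c, f : 𝒜×ℬ → ℝ be continuous with c(α,β) > 0 for all (α,β) and such that each triple (A(α,β), b(α,β), c(α,β)) satisfies the Cordes condition with constants λ, δ. Set γ(α,β) := (tr A(α,β) + c(α,β)/λ)/(|A(α,β)|² + |b(α,β)|²/(2λ) + c(α,β)²/λ²) and, for an n×n real symmetric matrix M, p ∈ ℝⁿ and u ∈ ℝ, define G(M,p,u) := inf_{α∈𝒜} sup_{β∈ℬ} [ γ(α,β)·( −A(α,β):M − b(α,β)·p + c(α,β)·u − f(α,β) ) ]. Then for all (M₁,p₁,u₁) and (M₂,p₂,u₂), writing δM := M₁−M₂, δp := p₁−p₂, δu := u₁−u₂, one has | G(M₁,p₁,u₁) − G(M₂,p₂,u₂) − (λ·δu − tr(δM)) | ≤ √(1−δ) · √(|δM|² + 2λ|δp|² + λ²δu²). -/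
open Matrix BigOperators

/-- Frobenius inner product `A : M = tr(Aᵀ M)` of two real `n × n` matrices. -/
noncomputable def fip {n : ℕ} (A M : Matrix (Fin n) (Fin n) ℝ) : ℝ := (Aᵀ * M).trace

/-- Renormalization function `γ = (tr A + c/λ) / (|A|² + |b|²/(2λ) + c²/λ²)`. -/
noncomputable def gam {n : ℕ} (lam : ℝ) (A : Matrix (Fin n) (Fin n) ℝ)
    (b : Fin n → ℝ) (c : ℝ) : ℝ :=
  (A.trace + c / lam) / (fip A A + (∑ i, b i ^ 2) / (2 * lam) + c ^ 2 / lam ^ 2)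

/-- The renormalized HJBI nonlinearity
`G(M,p,u) = inf_α sup_β γ(α,β)·(−A(α,β):M − b(α,β)·p + c(α,β)u − f(α,β))`. -/
noncomputable def Gop {n : ℕ} {𝒜 ℬ : Type*} (lam : ℝ)
    (A : 𝒜 × ℬ → Matrix (Fin n) (Fin n) ℝ) (b : 𝒜 × ℬ → Fin n → ℝ)
    (c f : 𝒜 × ℬ → ℝ)
    (M : Matrix (Fin n) (Fin n) ℝ) (p : Fin n → ℝ) (u : ℝ) : ℝ :=
  ⨅ α : 𝒜, ⨆ β : ℬ,
    gam lam (A (α, β)) (b (α, β)) (c (α, β)) *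
      (-(fip (A (α, β)) M) - (∑ i, b (α, β) i * p i) + c (α, β) * u - f (α, β))

lemma fip_eq_sum {n : ℕ} (A M : Matrix (Fin n) (Fin n) ℝ) :
    fip A M = ∑ x : Fin n × Fin n, A x.1 x.2 * M x.1 x.2 := by
  rw [Fintype.sum_prod_type, Finset.sum_comm]
  simp [fip, Matrix.trace, Matrix.mul_apply]

lemma fip_sub_right {n : ℕ} (A M N : Matrix (Fin n) (Fin n) ℝ) :
    fip A (M - N) = fip A M - fip A N := by
  simp [fip, Matrix.mul_sub]

lemma fip_self_nonneg {n : ℕ} (A : Matrix (Fin n) (Fin n) ℝ) : 0 ≤ fip A A := by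
  rw [fip_eq_sum]
  exact Finset.sum_nonneg fun x _ => mul_self_nonneg _

lemma den_pos {n : ℕ} {lam : ℝ} (hlam : 0 < lam) (A : Matrix (Fin n) (Fin n) ℝ)
    (b : Fin n → ℝ) {c : ℝ} (hc : 0 < c) :
    0 < fip A A + (∑ i, b i ^ 2) / (2 * lam) + c ^ 2 / lam ^ 2 := by
  have h1 := fip_self_nonneg A
  have h2 : 0 ≤ ∑ i, b i ^ 2 := Finset.sum_nonneg fun i _ => sq_nonneg _
  positivity

lemma cs_three {ι κ : Type*} [Fintype ι] [Fintype κ] (X Y : ι → ℝ) (x y : κ → ℝ) (s t : ℝ) :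
    ((∑ i, X i * Y i) + (∑ i, x i * y i) + s * t) ^ 2 ≤
      ((∑ i, X i ^ 2) + (∑ i, x i ^ 2) + s ^ 2) * ((∑ i, Y i ^ 2) + (∑ i, y i ^ 2) + t ^ 2) := by
  have h := Finset.sum_mul_sq_le_sq_mul_sq (Finset.univ : Finset ((ι ⊕ κ) ⊕ Unit))
    (Sum.elim (Sum.elim X x) (fun _ => s)) (Sum.elim (Sum.elim Y y) (fun _ => t))
  simpa [Fintype.sum_sum_type] using h

lemma pointwise {n : ℕ} {lam δ : ℝ} (hlam : 0 < lam) (hδ : δ ∈ Set.Ioo (0 : ℝ) 1)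
    (A : Matrix (Fin n) (Fin n) ℝ) (b : Fin n → ℝ) (c : ℝ) (hc : 0 < c)
    (hC : fip A A + (∑ i, b i ^ 2) / (2 * lam) + c ^ 2 / lam ^ 2
      ≤ (1 / ((n : ℝ) + δ)) * (A.trace + c / lam) ^ 2)
    (M : Matrix (Fin n) (Fin n) ℝ) (p : Fin n → ℝ) (u : ℝ) :
    |gam lam A b c * (-(fip A M) - (∑ i, b i * p i) + c * u) - (lam * u - M.trace)|
      ≤ Real.sqrt (1 - δ) *
        Real.sqrt (fip M M + 2 * lam * (∑ i, p i ^ 2) + lam ^ 2 * u ^ 2) := by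
  have hD := den_pos hlam A b hc
  obtain ⟨hδ0, hδ1⟩ := hδ
  have hg : gam lam A b c * (fip A A + (∑ i, b i ^ 2) / (2 * lam) + c ^ 2 / lam ^ 2)
      = A.trace + c / lam := by
    unfold gam
    exact div_mul_cancel₀ _ hD.ne'
  set g := gam lam A b c with hgdef
  set D := fip A A + (∑ i, b i ^ 2) / (2 * lam) + c ^ 2 / lam ^ 2 with hDdef
  have hnδ : 0 < (n : ℝ) + δ := by positivity
  have hgD : (n : ℝ) + δ ≤ g ^ 2 * D := by
    rw [← hg, one_div, ← div_eq_inv_mul, le_div_iff₀ hnδ] at hC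
    have : D * ((n : ℝ) + δ) ≤ D * (g ^ 2 * D) := by nlinarith
    exact le_of_mul_le_mul_left this hD
  rw [← Real.sqrt_mul (by linarith)]
  apply Real.abs_le_sqrt
  have hsq : Real.sqrt (2 * lam) ^ 2 = 2 * lam := Real.sq_sqrt (by positivity)
  have hs0 : Real.sqrt (2 * lam) ≠ 0 := by positivity
  set r := Real.sqrt (2 * lam) with hr
  have key := cs_three (fun x : Fin n × Fin n => (1 - g • A) x.1 x.2) (fun x => M x.1 x.2)
    (fun i => -g * b i / r) (fun i => r * p i) (g * c / lam - 1) (lam * u)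
  have e1 : ∑ x : Fin n × Fin n, (1 - g • A) x.1 x.2 * M x.1 x.2 = M.trace - g * fip A M := by
    rw [← fip_eq_sum]
    simp [fip, Matrix.sub_mul]
  have e2 : ∑ i, (-g * b i / r) * (r * p i) = - g * ∑ i, b i * p i := by
    rw [Finset.mul_sum]
    refine Finset.sum_congr rfl fun i _ => ?_
    field_simp
  have e3 : ∑ x : Fin n × Fin n, ((1 - g • A) x.1 x.2) ^ 2
      = n - 2 * g * A.trace + g ^ 2 * fip A A := by
    simp_rw [pow_two]
    rw [← fip_eq_sum]
    simp [fip, Matrix.sub_mul, Matrix.mul_sub]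
    ring
  have e4 : ∑ i, (-g * b i / r) ^ 2 = g ^ 2 * ((∑ i, b i ^ 2) / (2 * lam)) := by
    rw [Finset.sum_div, Finset.mul_sum]
    refine Finset.sum_congr rfl fun i _ => ?_
    rw [div_pow, hsq]
    ring
  have e5 : ∑ x : Fin n × Fin n, (M x.1 x.2) ^ 2 = fip M M := by
    rw [fip_eq_sum]
    simp_rw [pow_two]
  have e6 : ∑ i, (r * p i) ^ 2 = 2 * lam * ∑ i, p i ^ 2 := by
    rw [Finset.mul_sum]
    refine Finset.sum_congr rfl fun i _ => ?_
    rw [mul_pow, hsq]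
  rw [e1, e2, e3, e4, e5, e6] at key
  have hl : g * (-(fip A M) - (∑ i, b i * p i) + c * u) - (lam * u - M.trace)
      = M.trace - g * fip A M + -g * ∑ i, b i * p i + (g * c / lam - 1) * (lam * u) := by
    field_simp
    ring
  rw [hl]
  refine key.trans ?_
  rw [mul_pow lam u 2]
  refine mul_le_mul_of_nonneg_right ?_ ?_
  · have : (n : ℝ) - 2 * g * A.trace + g ^ 2 * fip A A + g ^ 2 * ((∑ i, b i ^ 2) / (2 * lam))
        + (g * c / lam - 1) ^ 2 = n + 1 - 2 * g * (A.trace + c / lam) + g ^ 2 * D := by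
      rw [hDdef]
      ring
    rw [this, ← hg]
    nlinarith
  · have := fip_self_nonneg M
    have h2 : 0 ≤ ∑ i, p i ^ 2 := Finset.sum_nonneg fun i _ => sq_nonneg _
    positivity

lemma infsup_le {𝒜 ℬ : Type*} [Nonempty 𝒜] [Nonempty ℬ] (F₁ F₂ : 𝒜 × ℬ → ℝ) (K B : ℝ)
    (h1 : ∀ q, |F₁ q| ≤ B) (h2 : ∀ q, |F₂ q| ≤ B) (h : ∀ q, F₁ q ≤ F₂ q + K) :
    (⨅ α : 𝒜, ⨆ β : ℬ, F₁ (α, β)) ≤ (⨅ α : 𝒜, ⨆ β : ℬ, F₂ (α, β)) + K := by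
  rw [← sub_le_iff_le_add]
  refine le_ciInf fun α => ?_
  rw [sub_le_iff_le_add]
  have hb1 : ∀ α, BddAbove (Set.range fun β => F₁ (α, β)) := fun α =>
    ⟨B, by rintro _ ⟨β, rfl⟩; exact (abs_le.1 (h1 _)).2⟩
  have hb2 : BddAbove (Set.range fun β => F₂ (α, β)) :=
    ⟨B, by rintro _ ⟨β, rfl⟩; exact (abs_le.1 (h2 _)).2⟩
  have hb : BddBelow (Set.range fun α => ⨆ β : ℬ, F₁ (α, β)) := by
    refine ⟨-B, ?_⟩
    rintro _ ⟨a, rfl⟩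
    obtain ⟨β⟩ := ‹Nonempty ℬ›
    exact (abs_le.1 (h1 (a, β))).1.trans (le_ciSup (hb1 a) β)
  refine (ciInf_le hb α).trans (ciSup_le fun β => (h _).trans ?_)
  have := le_ciSup hb2 β
  linarith

/-- Cordes estimate for the renormalized inf-sup operator. -/
theorem stmt3 {n : ℕ} (hn : 1 ≤ n) (lam δ : ℝ) (hlam : 0 < lam)
    (hδ : δ ∈ Set.Ioo (0 : ℝ) 1)
    {𝒜 ℬ : Type*} [MetricSpace 𝒜] [CompactSpace 𝒜] [Nonempty 𝒜]
    [MetricSpace ℬ] [CompactSpace ℬ] [Nonempty ℬ]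
    (A : 𝒜 × ℬ → Matrix (Fin n) (Fin n) ℝ) (b : 𝒜 × ℬ → Fin n → ℝ)
    (c f : 𝒜 × ℬ → ℝ)
    (hAc : Continuous A) (hbc : Continuous b) (hcc : Continuous c) (hfc : Continuous f)
    (hAsymm : ∀ q, (A q).IsSymm)
    (hcpos : ∀ q, 0 < c q)
    (hCordes : ∀ q, fip (A q) (A q) + (∑ i, b q i ^ 2) / (2 * lam) + c q ^ 2 / lam ^ 2
      ≤ (1 / ((n : ℝ) + δ)) * ((A q).trace + c q / lam) ^ 2) :
    ∀ (M₁ M₂ : Matrix (Fin n) (Fin n) ℝ), M₁.IsSymm → M₂.IsSymm →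
      ∀ (p₁ p₂ : Fin n → ℝ) (u₁ u₂ : ℝ),
      |Gop lam A b c f M₁ p₁ u₁ - Gop lam A b c f M₂ p₂ u₂
          - (lam * (u₁ - u₂) - (M₁ - M₂).trace)|
        ≤ Real.sqrt (1 - δ) *
            Real.sqrt (fip (M₁ - M₂) (M₁ - M₂) + 2 * lam * (∑ i, (p₁ i - p₂ i) ^ 2)
              + lam ^ 2 * (u₁ - u₂) ^ 2) := by
  intro M₁ M₂ _ _ p₁ p₂ u₁ u₂
  have hcont : ∀ (M : Matrix (Fin n) (Fin n) ℝ) (p : Fin n → ℝ) (u : ℝ),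
      Continuous fun q => gam lam (A q) (b q) (c q) *
        (-(fip (A q) M) - (∑ i, b q i * p i) + c q * u - f q) := by
    intro M p u
    have hb' : ∀ i, Continuous fun q => b q i := fun i => (continuous_apply i).comp hbc
    have hA' : ∀ i j, Continuous fun q => A q i j := fun i j => hAc.matrix_elem i j
    have hg : Continuous fun q => gam lam (A q) (b q) (c q) := by
      unfold gam
      refine Continuous.div ?_ ?_ fun q => (den_pos hlam (A q) (b q) (hcpos q)).ne'
      · exact hAc.matrix_trace.add (hcc.div_const _)
      · simp only [fip_eq_sum]
        fun_prop
    refine hg.mul ?_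
    simp only [fip_eq_sum]
    fun_prop
  have hbdd : ∀ (M : Matrix (Fin n) (Fin n) ℝ) (p : Fin n → ℝ) (u : ℝ),
      ∃ B, ∀ q, |gam lam (A q) (b q) (c q) *
        (-(fip (A q) M) - (∑ i, b q i * p i) + c q * u - f q)| ≤ B := by
    intro M p u
    obtain ⟨B, hB⟩ := isCompact_univ.exists_bound_of_continuousOn (hcont M p u).continuousOn
    exact ⟨B, fun q => hB q (Set.mem_univ q)⟩
  obtain ⟨B₁, hB₁⟩ := hbdd M₁ p₁ u₁
  obtain ⟨B₂, hB₂⟩ := hbdd M₂ p₂ u₂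
  have hB₁' := fun q => (hB₁ q).trans (le_max_left B₁ B₂)
  have hB₂' := fun q => (hB₂ q).trans (le_max_right B₁ B₂)
  have hpt := fun q => pointwise hlam hδ (A q) (b q) (c q) (hcpos q) (hCordes q)
    (M₁ - M₂) (fun i => p₁ i - p₂ i) (u₁ - u₂)
  simp only [fip_sub_right (A _), mul_sub (b _ _), Finset.sum_sub_distrib] at hpt
  generalize Real.sqrt (1 - δ) * Real.sqrt (fip (M₁ - M₂) (M₁ - M₂)
    + 2 * lam * (∑ i, (p₁ i - p₂ i) ^ 2) + lam ^ 2 * (u₁ - u₂) ^ 2) = R at hpt ⊢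
  generalize lam * (u₁ - u₂) - (M₁ - M₂).trace = L at hpt ⊢
  have k1 := infsup_le _ _ (L + R) _ hB₁' hB₂' fun q => by
    have := (abs_le.1 (hpt q)).2
    linarith
  have k2 := infsup_le _ _ (-L + R) _ hB₂' hB₁' fun q => by
    have := (abs_le.1 (hpt q)).1
    linarith
  unfold Gop
  rw [abs_le]
  constructor <;> linarith
end

section
/- Let n ≥ 1, λ > 0, δ ∈ (0,1). Let 𝒜, ℬ be nonempty compact metric spaces and let A : 𝒜×ℬ → (n×n real symmetric matrices), b : 𝒜×ℬ → ℝⁿ, c, f : 𝒜×ℬ → ℝ be continuous with c(α,β) > 0 for all (α,β) and such that each triple (A(α,β), b(α,β), c(α,β)) satisfies the Cordes condition with constants λ, δ. Set γ(α,β) := (tr A(α,β) + c(α,β)/λ)/(|A(α,β)|² + |b(α,β)|²/(2λ) + c(α,β)²/λ²) and, for an n×n real symmetric matrix M, p ∈ ℝⁿ and u ∈ ℝ, define G(M,p,u) := inf_{α∈𝒜} sup_{β∈ℬ} [ γ(α,β)·( −A(α,β):M − b(α,β)·p + c(α,β)·u − f(α,β) ) ]. Then for all (M₁,p₁,u₁)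 and (M₂,p₂,u₂), writing δM := M₁−M₂, δp := p₁−p₂, δu := u₁−u₂, one has | G(M₁,p₁,u₁) − G(M₂,p₂,u₂) | ≤ (√(1−δ) + √(n+1)) · √(|δM|² + 2λ|δp|² + λ²δu²). -/
open Matrix BigOperators

lemma fip_eq {n : ℕ} (A M : Matrix (Fin n) (Fin n) ℝ) :
    fip A M = ∑ q : Fin n × Fin n, A q.1 q.2 * M q.1 q.2 := by
  rw [Fintype.sum_prod_type, Finset.sum_comm]
  simp [fip, Matrix.trace, Matrix.mul_apply]

lemma cs_gen {n : ℕ} (A M : Matrix (Fin n) (Fin n) ℝ) (b p : Fin n → ℝ) (c u : ℝ) :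
    (fip A M + ∑ i, b i * p i + c * u) ^ 2 ≤
      (fip A A + ∑ i, b i ^ 2 + c ^ 2) * (fip M M + ∑ i, p i ^ 2 + u ^ 2) := by
  have h := Finset.sum_mul_sq_le_sq_mul_sq (Finset.univ : Finset ((Fin n × Fin n) ⊕ Fin n ⊕ Unit))
    (Sum.elim (fun q => A q.1 q.2) (Sum.elim b (fun _ => c)))
    (Sum.elim (fun q => M q.1 q.2) (Sum.elim p (fun _ => u)))
  simp only [Fintype.sum_sum_type, Sum.elim_inl, Sum.elim_inr, Finset.univ_unique,
    Finset.sum_singleton] at h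
  simp only [fip_eq, ← pow_two]
  simpa only [add_assoc] using h

lemma key {n : ℕ} {lam : ℝ} (hlam : 0 < lam) (A M : Matrix (Fin n) (Fin n) ℝ)
    (b p : Fin n → ℝ) {c : ℝ} (u : ℝ) (hc : 0 < c) :
    |gam lam A b c * (-(fip A M) - (∑ i, b i * p i) + c * u)| ≤
      Real.sqrt ((n : ℝ) + 1) *
        Real.sqrt (fip M M + 2 * lam * (∑ i, p i ^ 2) + lam ^ 2 * u ^ 2) := by
  have hD := den_pos hlam A b hc
  have hs : 0 < Real.sqrt (2 * lam) := Real.sqrt_pos.2 (by positivity)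
  have hs2 : Real.sqrt (2 * lam) ^ 2 = 2 * lam := Real.sq_sqrt (by positivity)
  set s := Real.sqrt (2 * lam)
  have hb : ∑ i, (b i / s) ^ 2 = (∑ i, b i ^ 2) / (2 * lam) := by
    rw [Finset.sum_div]; exact Finset.sum_congr rfl fun i _ => by rw [div_pow, hs2]
  have h1 := cs_gen A M (fun i => b i / s) (fun i => s * p i) (c / lam) (-(lam * u))
  have h2 := cs_gen A 1 (fun i => b i / s) (fun _ => 0) (c / lam) 1
  have e1 : ∑ i, b i / s * (s * p i) = ∑ i, b i * p i :=
    Finset.sum_congr rfl fun i _ => by field_simp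
  have e2 : ∑ i, (s * p i) ^ 2 = 2 * lam * ∑ i, p i ^ 2 := by
    rw [Finset.mul_sum]; exact Finset.sum_congr rfl fun i _ => by rw [mul_pow, hs2]
  have e3 : c / lam * -(lam * u) = -(c * u) := by field_simp
  have e4 : fip A 1 = A.trace := by simp [fip]
  have e5 : fip (1 : Matrix (Fin n) (Fin n) ℝ) 1 = n := by simp [fip]
  have e6 : (-(lam * u)) ^ 2 = lam ^ 2 * u ^ 2 := by ring
  simp only [hb, e1, e2, e3, e6, div_pow c] at h1
  simp only [hb, e4, e5, div_pow c, mul_zero, Finset.sum_const_zero, add_zero, mul_one, one_pow,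
    ne_eq, OfNat.ofNat_ne_zero, not_false_eq_true, zero_pow] at h2
  rw [← Real.sqrt_mul (by positivity)]
  apply Real.abs_le_sqrt
  unfold gam
  set D := fip A A + (∑ i, b i ^ 2) / (2 * lam) + c ^ 2 / lam ^ 2
  set N := fip M M + 2 * lam * (∑ i, p i ^ 2) + lam ^ 2 * u ^ 2
  rw [div_mul_eq_mul_div, div_pow, div_le_iff₀ (by positivity)]
  calc _ = (A.trace + c / lam) ^ 2 * (fip A M + ∑ i, b i * p i + -(c * u)) ^ 2 := by ring
    _ ≤ (D * (n + 1)) * (D * N) := mul_le_mul h2 h1 (sq_nonneg _) (by positivity)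
    _ = _ := by ring

lemma infsup_le_s4 {𝒜 ℬ : Type*} [Nonempty 𝒜] [Nonempty ℬ] (F H : 𝒜 × ℬ → ℝ) (K : ℝ)
    (hF : BddBelow (Set.range F)) (hF' : BddAbove (Set.range F))
    (hH' : BddAbove (Set.range H)) (h : ∀ q, F q ≤ H q + K) :
    (⨅ α, ⨆ β, F (α, β)) ≤ (⨅ α, ⨆ β, H (α, β)) + K := by
  have bd : ∀ (E : 𝒜 × ℬ → ℝ), BddAbove (Set.range E) →
      ∀ α, BddAbove (Set.range fun β => E (α, β)) := by
    rintro E ⟨m, hm⟩ α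
    refine ⟨m, ?_⟩
    rintro _ ⟨β, rfl⟩
    exact hm ⟨_, rfl⟩
  rw [← sub_le_iff_le_add]
  refine le_ciInf fun α => ?_
  rw [sub_le_iff_le_add]
  have hb : BddBelow (Set.range fun α => ⨆ β, F (α, β)) := by
    obtain ⟨m, hm⟩ := hF
    refine ⟨m, ?_⟩
    rintro _ ⟨α, rfl⟩
    obtain ⟨β⟩ := ‹Nonempty ℬ›
    exact (hm ⟨(α, β), rfl⟩).trans (le_ciSup (bd F hF' α) β)
  refine (ciInf_le hb α).trans (ciSup_le fun β => (h _).trans ?_)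
  gcongr
  exact le_ciSup (bd H hH' α) β

/-- Lipschitz estimate for the renormalized inf-sup operator. -/
theorem stmt4 {n : ℕ} (hn : 1 ≤ n) (lam δ : ℝ) (hlam : 0 < lam)
    (hδ : δ ∈ Set.Ioo (0 : ℝ) 1)
    {𝒜 ℬ : Type*} [MetricSpace 𝒜] [CompactSpace 𝒜] [Nonempty 𝒜]
    [MetricSpace ℬ] [CompactSpace ℬ] [Nonempty ℬ]
    (A : 𝒜 × ℬ → Matrix (Fin n) (Fin n) ℝ) (b : 𝒜 × ℬ → Fin n → ℝ)
    (c f : 𝒜 × ℬ → ℝ)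
    (hAc : Continuous A) (hbc : Continuous b) (hcc : Continuous c) (hfc : Continuous f)
    (hAsymm : ∀ q, (A q).IsSymm)
    (hcpos : ∀ q, 0 < c q)
    (hCordes : ∀ q, fip (A q) (A q) + (∑ i, b q i ^ 2) / (2 * lam) + c q ^ 2 / lam ^ 2
      ≤ (1 / ((n : ℝ) + δ)) * ((A q).trace + c q / lam) ^ 2) :
    ∀ (M₁ M₂ : Matrix (Fin n) (Fin n) ℝ), M₁.IsSymm → M₂.IsSymm →
      ∀ (p₁ p₂ : Fin n → ℝ) (u₁ u₂ : ℝ),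
      |Gop lam A b c f M₁ p₁ u₁ - Gop lam A b c f M₂ p₂ u₂|
        ≤ (Real.sqrt (1 - δ) + Real.sqrt ((n : ℝ) + 1)) *
            Real.sqrt (fip (M₁ - M₂) (M₁ - M₂) + 2 * lam * (∑ i, (p₁ i - p₂ i) ^ 2)
              + lam ^ 2 * (u₁ - u₂) ^ 2) := by
  intro M₁ M₂ _ _ p₁ p₂ u₁ u₂
  have hcont : ∀ (M : Matrix (Fin n) (Fin n) ℝ) (p : Fin n → ℝ) (u : ℝ),
      Continuous fun q => gam lam (A q) (b q) (c q) *
        (-(fip (A q) M) - (∑ i, b q i * p i) + c q * u - f q) := by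
    intro M p u
    have hg : Continuous fun q => gam lam (A q) (b q) (c q) := by
      refine Continuous.div ?_ ?_ fun q => (den_pos hlam (A q) (b q) (hcpos q)).ne'
      · exact (Continuous.matrix_trace hAc).add (hcc.div_const _)
      · unfold fip
        have := Continuous.matrix_trace (hAc.matrix_transpose.matrix_mul hAc)
        fun_prop
    have hm : Continuous fun q => fip (A q) M :=
      Continuous.matrix_trace (hAc.matrix_transpose.matrix_mul continuous_const)
    fun_prop
  have hle : ∀ (M₁ M₂ : Matrix (Fin n) (Fin n) ℝ) (p₁ p₂ : Fin n → ℝ) (u₁ u₂ : ℝ),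
      Gop lam A b c f M₁ p₁ u₁ ≤ Gop lam A b c f M₂ p₂ u₂ +
        Real.sqrt ((n : ℝ) + 1) *
            Real.sqrt (fip (M₁ - M₂) (M₁ - M₂) + 2 * lam * (∑ i, (p₁ i - p₂ i) ^ 2)
              + lam ^ 2 * (u₁ - u₂) ^ 2) := by
    intro M₁ M₂ p₁ p₂ u₁ u₂
    refine infsup_le_s4
      (fun q => gam lam (A q) (b q) (c q) *
        (-(fip (A q) M₁) - (∑ i, b q i * p₁ i) + c q * u₁ - f q))
      (fun q => gam lam (A q) (b q) (c q) *
        (-(fip (A q) M₂) - (∑ i, b q i * p₂ i) + c q * u₂ - f q)) _ (isCompact_range (hcont M₁ p₁ u₁)).bddBelow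
      (isCompact_range (hcont M₁ p₁ u₁)).bddAbove
      (isCompact_range (hcont M₂ p₂ u₂)).bddAbove fun q => ?_
    have hk := (le_abs_self _).trans
      (key hlam (A q) (M₁ - M₂) (b q) (fun i => p₁ i - p₂ i) (u₁ - u₂) (hcpos q))
    have e1 : fip (A q) (M₁ - M₂) = fip (A q) M₁ - fip (A q) M₂ := by
      simp [fip, Matrix.mul_sub]
    have e2 : ∑ i, b q i * (p₁ i - p₂ i) = ∑ i, b q i * p₁ i - ∑ i, b q i * p₂ i := by
      simp [mul_sub]
    rw [e1, e2] at hk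
    rw [← sub_le_iff_le_add']
    refine le_trans (le_of_eq ?_) hk
    ring
  have h1 := hle M₁ M₂ p₁ p₂ u₁ u₂
  have h2 := hle M₂ M₁ p₂ p₁ u₂ u₁
  have e1 : fip (M₂ - M₁) (M₂ - M₁) = fip (M₁ - M₂) (M₁ - M₂) := by
    rw [← neg_sub M₁ M₂]; simp only [fip, Matrix.transpose_neg, neg_mul_neg]
  have e2 : ∑ i, (p₂ i - p₁ i) ^ 2 = ∑ i, (p₁ i - p₂ i) ^ 2 :=
    Finset.sum_congr rfl fun i _ => by ring
  rw [e1, e2, show (u₂ - u₁) ^ 2 = (u₁ - u₂) ^ 2 by ring] at h2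
  rw [add_mul]
  refine le_trans (abs_le.2 ⟨?_, ?_⟩) (le_add_of_nonneg_left (by positivity))
  · linarith
  · linarith
end

section
/- In the setting of a Cordes coefficient family: if u : ℝⁿ → ℝ is smooth, ℤⁿ-periodic, and satisfies F_γ[u](y) = 0 for all y ∈ ℝⁿ, then (∫_Y (L_λ u)²)^{1/2} ≤ (1 − √(1−δ))^{-1} · (∫_Y (F_γ[0])²)^{1/2}, where F_γ[0](y) := inf_{α∈𝒜} sup_{β∈ℬ} [ −γ(y,α,β)·f(y,α,β) ] is the operator applied to the zero function. -/
open MeasureTheory Matrix BigOperators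

/-- Partial derivative `∂v/∂xᵢ` of a function on `ℝⁿ = Fin n → ℝ`. -/
noncomputable def pd {n : ℕ} (i : Fin n) (v : (Fin n → ℝ) → ℝ) (x : Fin n → ℝ) : ℝ :=
  fderiv ℝ v x (Pi.single i 1)

/-- Hessian matrix of a function on `ℝⁿ`. -/
noncomputable def hess {n : ℕ} (v : (Fin n → ℝ) → ℝ) (x : Fin n → ℝ) :
    Matrix (Fin n) (Fin n) ℝ :=
  Matrix.of fun i j => pd i (pd j v) x

/-- The operator `L_λ v = λ v − Δ v`. -/
noncomputable def Llam {n : ℕ} (lam : ℝ) (v : (Fin n → ℝ) → ℝ) (x : Fin n → ℝ) : ℝ :=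
  lam * v x - ∑ i, pd i (pd i v) x

/-- `ℤⁿ`-periodicity of a function on `ℝⁿ`. -/
def ZPeriodic {n : ℕ} (v : (Fin n → ℝ) → ℝ) : Prop :=
  ∀ (x : Fin n → ℝ) (z : Fin n → ℤ), v (x + fun i => (z i : ℝ)) = v x

/-- The renormalized HJBI operator
`F_γ[v](y) = inf_α sup_β γ·(−A:∇²v − b·∇v + c v − f)` evaluated at `(y,α,β)`. -/
noncomputable def Fgam {n : ℕ} {𝒜 ℬ : Type} (lam : ℝ)
    (A : (Fin n → ℝ) × 𝒜 × ℬ → Matrix (Fin n) (Fin n) ℝ)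
    (b : (Fin n → ℝ) × 𝒜 × ℬ → Fin n → ℝ)
    (c f : (Fin n → ℝ) × 𝒜 × ℬ → ℝ)
    (v : (Fin n → ℝ) → ℝ) (y : Fin n → ℝ) : ℝ :=
  ⨅ α : 𝒜, ⨆ β : ℬ,
    gam lam (A (y, α, β)) (b (y, α, β)) (c (y, α, β)) *
      (-(fip (A (y, α, β)) (hess v y)) - (∑ i, b (y, α, β) i * pd i v y)
        + c (y, α, β) * v y - f (y, α, β))

theorem aux_cs {n : ℕ} (M H : Fin n → Fin n → ℝ) (s p : Fin n → ℝ) (r w : ℝ) :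
    (∑ i, ∑ j, M i j * H i j + ∑ i, s i * p i + r * w) ^ 2 ≤
      (∑ i, ∑ j, M i j ^ 2 + ∑ i, s i ^ 2 + r ^ 2) *
      (∑ i, ∑ j, H i j ^ 2 + ∑ i, p i ^ 2 + w ^ 2) := by
  have h := Finset.sum_mul_sq_le_sq_mul_sq (Finset.univ : Finset ((Fin n × Fin n) ⊕ (Fin n ⊕ Unit)))
    (Sum.elim (fun q => M q.1 q.2) (Sum.elim s (fun _ => r)))
    (Sum.elim (fun q => H q.1 q.2) (Sum.elim p (fun _ => w)))
  simpa [Fintype.sum_sum_type, Fintype.sum_prod_type, add_assoc] using h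

theorem aux_fip {n : ℕ} (A M : Matrix (Fin n) (Fin n) ℝ) :
    fip A M = ∑ i, ∑ j, A i j * M i j := by
  unfold fip
  simp only [Matrix.trace, Matrix.diag, Matrix.mul_apply, Matrix.transpose_apply]
  rw [Finset.sum_comm]

/-- The pointwise Cordes estimate. -/
theorem aux_point {n : ℕ} (lam δ : ℝ) (hlam : 0 < lam) (hδ : 0 < δ)
    (A : Matrix (Fin n) (Fin n) ℝ) (b : Fin n → ℝ) (c : ℝ) (hc : 0 < c)
    (hC : fip A A + (∑ i, b i ^ 2) / (2 * lam) + c ^ 2 / lam ^ 2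
      ≤ (1 / ((n : ℝ) + δ)) * (A.trace + c / lam) ^ 2)
    (H : Matrix (Fin n) (Fin n) ℝ) (p : Fin n → ℝ) (v : ℝ) :
    (gam lam A b c * (-(fip A H) - (∑ i, b i * p i) + c * v) - (lam * v - ∑ i, H i i)) ^ 2
      ≤ (1 - δ) * (∑ i, ∑ j, H i j ^ 2 + 2 * lam * ∑ i, p i ^ 2 + lam ^ 2 * v ^ 2) := by
  have hN : 0 < fip A A + (∑ i, b i ^ 2) / (2 * lam) + c ^ 2 / lam ^ 2 := by
    have h1 : 0 ≤ fip A A := by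
      rw [aux_fip]; exact Finset.sum_nonneg fun i _ => Finset.sum_nonneg fun j _ =>
        mul_self_nonneg _
    have h2 : 0 ≤ ∑ i, b i ^ 2 := Finset.sum_nonneg fun i _ => sq_nonneg _
    positivity
  have hg : gam lam A b c = (A.trace + c / lam) /
    (fip A A + (∑ i, b i ^ 2) / (2 * lam) + c ^ 2 / lam ^ 2) := rfl
  generalize gam lam A b c = g at *
  obtain ⟨μ, hμ, hμ2⟩ : ∃ μ : ℝ, 0 < μ ∧ μ ^ 2 = 2 * lam :=
    ⟨Real.sqrt (2 * lam), by positivity, Real.sq_sqrt (by positivity)⟩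
  have key := aux_cs (fun i j => (if i = j then 1 else 0) - g * A i j) H
    (fun i => -(g * b i / μ)) (fun i => μ * p i) (g * c / lam - 1) (lam * v)
  have e1 : ∑ i, ∑ j, ((if i = j then 1 else 0) - g * A i j) * H i j
      = ∑ i, H i i - g * fip A H := by
    rw [aux_fip]
    simp only [sub_mul, Finset.sum_sub_distrib, ite_mul, one_mul, zero_mul, Finset.sum_ite_eq,
      Finset.mem_univ, if_true, Finset.mul_sum, mul_assoc]
  have e2 : ∑ i, -(g * b i / μ) * (μ * p i) = - (g * ∑ i, b i * p i) := by
    rw [Finset.mul_sum, ← Finset.sum_neg_distrib]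
    refine Finset.sum_congr rfl fun i _ => ?_
    field_simp
  have e3 : ∑ i, ∑ j, (((if i = j then 1 else 0) - g * A i j) ^ 2 : ℝ)
      = n - 2 * g * A.trace + g ^ 2 * fip A A := by
    have : ∀ i j, (((if i = j then 1 else 0) - g * A i j) ^ 2 : ℝ)
      = (if i = j then 1 else 0) - (if i = j then 2 * g * A i j else 0) + g ^ 2 * (A i j * A i j) := by
      intro i j; split_ifs <;> ring
    simp only [this, Finset.sum_add_distrib, Finset.sum_sub_distrib, Finset.sum_ite_eq,
      Finset.mem_univ, if_true, ← Finset.mul_sum, aux_fip, Matrix.trace, Matrix.diag]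
    simp
  have e4 : ∑ i, (-(g * b i / μ)) ^ 2 = g ^ 2 * ((∑ i, b i ^ 2) / (2 * lam)) := by
    rw [← hμ2, Finset.sum_div, Finset.mul_sum]
    refine Finset.sum_congr rfl fun i _ => ?_
    field_simp
  have e5 : ∑ i, (μ * p i) ^ 2 = 2 * lam * ∑ i, p i ^ 2 := by
    rw [← hμ2, Finset.mul_sum]
    exact Finset.sum_congr rfl fun i _ => by ring
  rw [e1, e2, e3, e4, e5] at key
  have hle : n - 2 * g * A.trace + g ^ 2 * fip A A + g ^ 2 * ((∑ i, b i ^ 2) / (2 * lam))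
      + (g * c / lam - 1) ^ 2 ≤ 1 - δ := by
    have hT : (n + δ) ≤ g ^ 2 * (fip A A + (∑ i, b i ^ 2) / (2 * lam) + c ^ 2 / lam ^ 2) := by
      rw [hg, div_pow]
      have hnd : (0:ℝ) < n + δ := by positivity
      rw [div_mul_eq_mul_div, le_div_iff₀ (by positivity), pow_two (fip A A + _ + _), ← mul_assoc]
      refine mul_le_mul_of_nonneg_right ?_ hN.le
      rw [one_div, inv_mul_eq_div, le_div_iff₀ hnd] at hC
      linarith
    have hgN : g * (fip A A + (∑ i, b i ^ 2) / (2 * lam) + c ^ 2 / lam ^ 2) = A.trace + c / lam := by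
      rw [hg, div_mul_cancel₀ _ hN.ne']
    have h3 : g ^ 2 * (fip A A + (∑ i, b i ^ 2) / (2 * lam) + c ^ 2 / lam ^ 2)
      = g * (A.trace + c / lam) := by rw [← hgN]; ring
    have h4 : (g * c / lam - 1) ^ 2 = g ^ 2 * (c ^ 2 / lam ^ 2) - 2 * (g * (c / lam)) + 1 := by
      field_simp
      ring
    rw [h4]
    linarith
  have hQ : 0 ≤ ∑ i, ∑ j, H i j ^ 2 + 2 * lam * ∑ i, p i ^ 2 + (lam * v) ^ 2 := by
    have h1 : 0 ≤ ∑ i, ∑ j, H i j ^ 2 := Finset.sum_nonneg fun i _ =>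
      Finset.sum_nonneg fun j _ => sq_nonneg _
    have h2 : 0 ≤ ∑ i, p i ^ 2 := Finset.sum_nonneg fun i _ => sq_nonneg _
    positivity
  calc _ = _ := ?_
    _ ≤ _ := key
    _ ≤ _ := mul_le_mul_of_nonneg_right hle hQ
    _ = _ := by ring
  congr 1
  field_simp
  ring

theorem aux_pd_smooth {n : ℕ} (i : Fin n) {v : (Fin n → ℝ) → ℝ} (hv : ContDiff ℝ (⊤ : ℕ∞) v) :
    ContDiff ℝ (⊤ : ℕ∞) (pd i v) := by
  unfold pd
  exact (hv.fderiv_right (m := (⊤ : ℕ∞)) (by simp)).clm_apply contDiff_const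

theorem aux_pd_per {n : ℕ} (i : Fin n) {v : (Fin n → ℝ) → ℝ} (hv : ZPeriodic v) :
    ZPeriodic (pd i v) := by
  intro x z
  unfold pd
  rw [← fderiv_comp_add_right]
  have : (fun x => v (x + fun i => (z i : ℝ))) = v := funext fun x => hv x z
  rw [this]

theorem aux_pd_mul {n : ℕ} (i : Fin n) {v w : (Fin n → ℝ) → ℝ} (hv : ContDiff ℝ (⊤ : ℕ∞) v)
    (hw : ContDiff ℝ (⊤ : ℕ∞) w) (x : Fin n → ℝ) :
    pd i (fun x => v x * w x) x = v x * pd i w x + pd i v x * w x := by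
  unfold pd
  rw [fderiv_fun_mul (hv.differentiable (by simp) x) (hw.differentiable (by simp) x)]
  simp [mul_comm]

theorem aux_pd_comm {n : ℕ} (i j : Fin n) {v : (Fin n → ℝ) → ℝ} (hv : ContDiff ℝ (⊤ : ℕ∞) v)
    (x : Fin n → ℝ) : pd i (pd j v) x = pd j (pd i v) x := by
  have hd : DifferentiableAt ℝ (fderiv ℝ v) x :=
    (hv.fderiv_right (m := (⊤ : ℕ∞)) (by simp)).differentiable (by simp) x
  have hs : IsSymmSndFDerivAt ℝ v x :=
    (hv.contDiffAt (x := x)).isSymmSndFDerivAt (by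
      simp only [minSmoothness_of_isRCLikeNormedField]
      exact WithTop.coe_le_coe.2 (le_top : (2 : ℕ∞) ≤ ⊤))
  have : ∀ k l : Fin n, pd k (pd l v) x
      = fderiv ℝ (fderiv ℝ v) x (Pi.single k 1) (Pi.single l 1) := by
    intro k l
    have : pd l v = fun y => fderiv ℝ v y (Pi.single l 1) := rfl
    rw [this]
    unfold pd
    rw [fderiv_clm_apply hd (by fun_prop)]
    simp
  rw [this, this]
  exact hs _ _

theorem aux_int {n : ℕ} {v : (Fin n → ℝ) → ℝ} (hv : Continuous v) :
    IntegrableOn v (Set.Icc (0 : Fin n → ℝ) 1) :=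
  hv.continuousOn.integrableOn_compact isCompact_Icc

theorem aux_int_pd {n : ℕ} (i : Fin n) {v : (Fin n → ℝ) → ℝ} (hv : ContDiff ℝ (⊤ : ℕ∞) v)
    (hp : ZPeriodic v) : ∫ x in Set.Icc (0 : Fin n → ℝ) 1, pd i v x = 0 := by
  cases n with
  | zero => exact i.elim0
  | succ m =>
    have h := integral_divergence_of_hasFDerivAt_off_countable' (E := ℝ) (0 : Fin (m+1) → ℝ) 1
      zero_le_one (fun k => if k = i then v else 0)
      (fun k x => if k = i then fderiv ℝ v x else 0) ∅ Set.countable_empty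
      (fun k => by
        split_ifs
        · exact hv.continuous.continuousOn
        · exact continuousOn_const)
      (fun x _ k => by
        split_ifs
        · exact (hv.differentiable (by simp) x).hasFDerivAt
        · exact hasFDerivAt_const 0 x)
      (by
        have : (fun x => ∑ k, (if k = i then fderiv ℝ v x else 0) (Pi.single k 1)) = pd i v := by
          funext x
          rw [Finset.sum_eq_single i]
          · simp [pd]
          · intro k _ hk; simp [hk]
          · simp
        rw [this]
        exact aux_int (aux_pd_smooth i hv).continuous)
    have e : ∀ x, ∑ k, (if k = i then fderiv ℝ v x else 0) (Pi.single k 1) = pd i v x := by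
      intro x
      rw [Finset.sum_eq_single i]
      · simp [pd]
      · intro k _ hk; simp [hk]
      · simp
    simp only [e] at h
    rw [h]
    refine Finset.sum_eq_zero fun k _ => ?_
    rw [sub_eq_zero]
    congr 1
    funext x
    by_cases hk : k = i
    · subst hk
      simp only [if_true]
      rw [← hp (Fin.insertNth k ((0 : Fin (m+1) → ℝ) k) x) (Pi.single k 1)]
      congr 1
      funext j
      refine Fin.succAboveCases k ?_ (fun j => ?_) j
      · simp
      · simp
    · simp [hk]

theorem aux_ibp {n : ℕ} (i : Fin n) {v w : (Fin n → ℝ) → ℝ} (hv : ContDiff ℝ (⊤ : ℕ∞) v)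
    (hw : ContDiff ℝ (⊤ : ℕ∞) w) (hvp : ZPeriodic v) (hwp : ZPeriodic w) :
    ∫ x in Set.Icc (0 : Fin n → ℝ) 1, v x * pd i w x
      = - ∫ x in Set.Icc (0 : Fin n → ℝ) 1, pd i v x * w x := by
  have h := aux_int_pd i (hv.mul hw) (fun x z => by rw [hvp x z, hwp x z])
  simp only [aux_pd_mul i hv hw] at h
  have c1 := hv.continuous
  have c2 := hw.continuous
  have c3 := (aux_pd_smooth i hv).continuous
  have c4 := (aux_pd_smooth i hw).continuous
  rw [integral_add (aux_int (by fun_prop)) (aux_int (by fun_prop))] at h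
  linarith

/-- The integral identity for `L_λ`. -/
theorem aux_ident {n : ℕ} (lam : ℝ) {u : (Fin n → ℝ) → ℝ} (hu : ContDiff ℝ (⊤ : ℕ∞) u)
    (hup : ZPeriodic u) :
    ∫ x in Set.Icc (0 : Fin n → ℝ) 1, (∑ i, ∑ j, hess u x i j ^ 2 + 2 * lam * ∑ i, pd i u x ^ 2
        + lam ^ 2 * u x ^ 2)
      = ∫ x in Set.Icc (0 : Fin n → ℝ) 1, (Llam lam u x) ^ 2 := by
  have s1 := fun i => aux_pd_smooth i hu
  have s2 := fun i j => aux_pd_smooth i (s1 j)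
  have p1 := fun i => aux_pd_per i hup
  have p2 := fun i j => aux_pd_per i (p1 j)
  have c0 := hu.continuous
  have c1 := fun i => (s1 i).continuous
  have c2 := fun i j => (s2 i j).continuous
  have hA : ∀ i, ∫ x in Set.Icc (0 : Fin n → ℝ) 1, u x * pd i (pd i u) x
      = - ∫ x in Set.Icc (0 : Fin n → ℝ) 1, pd i u x ^ 2 := by
    intro i
    rw [aux_ibp i hu (s1 i) hup (p1 i)]
    simp only [pow_two]
  have hB : ∀ i j, ∫ x in Set.Icc (0 : Fin n → ℝ) 1, pd i (pd i u) x * pd j (pd j u) x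
      = ∫ x in Set.Icc (0 : Fin n → ℝ) 1, pd i (pd j u) x ^ 2 := by
    intro i j
    have h1 := aux_ibp i (s1 i) (s2 j j) (p1 i) (p2 j j)
    have h2 := aux_ibp j (s1 i) (s2 i j) (p1 i) (p2 i j)
    simp only [aux_pd_comm i j (s1 j)] at h1
    simp only [aux_pd_comm j i hu] at h2
    simp only [pow_two]
    linarith
  have hL : ∀ x, (Llam lam u x) ^ 2 = lam ^ 2 * u x ^ 2
      + (∑ i, (-(2 * lam)) * (u x * pd i (pd i u) x))
      + ∑ i, ∑ j, pd i (pd i u) x * pd j (pd j u) x := by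
    intro x
    unfold Llam
    rw [← Finset.sum_mul_sum, ← Finset.mul_sum, ← Finset.mul_sum]
    ring
  have hQ : ∀ x, (∑ i, ∑ j, hess u x i j ^ 2 + 2 * lam * ∑ i, pd i u x ^ 2 + lam ^ 2 * u x ^ 2)
      = lam ^ 2 * u x ^ 2 + (∑ i, (2 * lam) * (pd i u x ^ 2))
      + ∑ i, ∑ j, pd i (pd j u) x ^ 2 := by
    intro x
    rw [← Finset.mul_sum]
    simp only [hess, Matrix.of_apply]
    ring
  simp only [hL, hQ]
  rw [integral_add (aux_int (by fun_prop)) (aux_int (by fun_prop)),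
    integral_add (aux_int (by fun_prop)) (aux_int (by fun_prop)),
    integral_add (aux_int (by fun_prop)) (aux_int (by fun_prop)),
    integral_add (aux_int (by fun_prop)) (aux_int (by fun_prop))]
  congr 1
  · congr 1
    rw [integral_finsetSum _ (fun i _ => aux_int (by fun_prop)),
      integral_finsetSum _ (fun i _ => aux_int (by fun_prop))]
    refine Finset.sum_congr rfl fun i _ => ?_
    rw [integral_const_mul, integral_const_mul, hA]
    ring
  · rw [integral_finsetSum _ (fun i _ => aux_int (by fun_prop)),
      integral_finsetSum _ (fun i _ => aux_int (by fun_prop))]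
    refine Finset.sum_congr rfl fun i _ => ?_
    rw [integral_finsetSum _ (fun j _ => aux_int (by fun_prop)),
      integral_finsetSum _ (fun j _ => aux_int (by fun_prop))]
    exact Finset.sum_congr rfl fun j _ => (hB i j).symm

/-- One-sided comparison of inf-sup of continuous functions on compact spaces. -/
theorem aux_infsup_le {𝒜 ℬ : Type} [MetricSpace 𝒜] [CompactSpace 𝒜] [Nonempty 𝒜]
    [MetricSpace ℬ] [CompactSpace ℬ] [Nonempty ℬ] (g h : 𝒜 × ℬ → ℝ) (hg : Continuous g)
    (hh : Continuous h) (K : ℝ) (H : ∀ q, g q ≤ h q + K) :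
    (⨅ α, ⨆ β, g (α, β)) ≤ (⨅ α, ⨆ β, h (α, β)) + K := by
  have bg := (isCompact_range hg)
  have bh := (isCompact_range hh)
  have ba : ∀ (k : 𝒜 × ℬ → ℝ), Continuous k → ∀ α, BddAbove (Set.range fun β => k (α, β)) := by
    intro k hk α
    exact (isCompact_range (by fun_prop)).bddAbove
  have bb : BddBelow (Set.range fun α => ⨆ β, g (α, β)) := by
    obtain ⟨m, hm⟩ := bg.bddBelow
    refine ⟨m, ?_⟩
    rintro _ ⟨α, rfl⟩
    obtain ⟨β⟩ := ‹Nonempty ℬ›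
    exact (hm ⟨(α, β), rfl⟩).trans (le_ciSup (ba g hg α) β)
  rw [← sub_le_iff_le_add]
  refine le_ciInf fun α => ?_
  rw [sub_le_iff_le_add]
  refine (ciInf_le bb α).trans (ciSup_le fun β => (H _).trans ?_)
  have := le_ciSup (ba h hh α) β
  linarith

theorem aux_infsup_cont {X 𝒜 ℬ : Type} [TopologicalSpace X] [MetricSpace 𝒜] [CompactSpace 𝒜]
    [MetricSpace ℬ] [CompactSpace ℬ] (g : X × 𝒜 × ℬ → ℝ) (hg : Continuous g) :
    Continuous fun x => ⨅ α, ⨆ β, g (x, α, β) := by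
  have h1 : Continuous fun q : X × 𝒜 => sSup ((fun β => g (q.1, q.2, β)) '' Set.univ) :=
    isCompact_univ.continuous_sSup (f := fun (q : X × 𝒜) β => g (q.1, q.2, β))
      (by simp only [Function.HasUncurry.uncurry, id]; fun_prop)
  have h2 : Continuous fun x : X => sInf ((fun α => sSup ((fun β => g (x, α, β)) '' Set.univ))
      '' Set.univ) :=
    isCompact_univ.continuous_sInf
      (f := fun (x : X) α => sSup ((fun β => g (x, α, β)) '' Set.univ)) h1
  simpa only [Set.image_univ, sInf_range, sSup_range] using h2

/-- a priori bound on the solution of the periodic HJBI problem. -/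
theorem stmt10 {n : ℕ} (hn : 1 ≤ n) (lam δ : ℝ) (hlam : 0 < lam)
    (hδ : δ ∈ Set.Ioo (0 : ℝ) 1)
    (𝒜 ℬ : Type) [MetricSpace 𝒜] [CompactSpace 𝒜] [Nonempty 𝒜]
    [MetricSpace ℬ] [CompactSpace ℬ] [Nonempty ℬ]
    (A : (Fin n → ℝ) × 𝒜 × ℬ → Matrix (Fin n) (Fin n) ℝ)
    (b : (Fin n → ℝ) × 𝒜 × ℬ → Fin n → ℝ)
    (c f : (Fin n → ℝ) × 𝒜 × ℬ → ℝ)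
    (hAc : Continuous A) (hbc : Continuous b) (hcc : Continuous c) (hfc : Continuous f)
    (hAsymm : ∀ q, (A q).IsSymm)
    (hAper : ∀ (y : Fin n → ℝ) (z : Fin n → ℤ) (α : 𝒜) (β : ℬ),
      A ((y + fun i => (z i : ℝ)), α, β) = A (y, α, β))
    (hbper : ∀ (y : Fin n → ℝ) (z : Fin n → ℤ) (α : 𝒜) (β : ℬ),
      b ((y + fun i => (z i : ℝ)), α, β) = b (y, α, β))
    (hcper : ∀ (y : Fin n → ℝ) (z : Fin n → ℤ) (α : 𝒜) (β : ℬ),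
      c ((y + fun i => (z i : ℝ)), α, β) = c (y, α, β))
    (hfper : ∀ (y : Fin n → ℝ) (z : Fin n → ℤ) (α : 𝒜) (β : ℬ),
      f ((y + fun i => (z i : ℝ)), α, β) = f (y, α, β))
    (hcpos : ∀ q, 0 < c q)
    (hCordes : ∀ q, fip (A q) (A q) + (∑ i, b q i ^ 2) / (2 * lam) + c q ^ 2 / lam ^ 2
      ≤ (1 / ((n : ℝ) + δ)) * ((A q).trace + c q / lam) ^ 2)
    (u : (Fin n → ℝ) → ℝ)
    (hu : ContDiff ℝ (⊤ : ℕ∞) u) (hup : ZPeriodic u)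
    (hsol : ∀ y : Fin n → ℝ, Fgam lam A b c f u y = 0) :
    Real.sqrt (∫ x in Set.Icc (0 : Fin n → ℝ) 1, (Llam lam u x) ^ 2)
      ≤ (1 - Real.sqrt (1 - δ))⁻¹
        * Real.sqrt (∫ x in Set.Icc (0 : Fin n → ℝ) 1,
            (Fgam lam A b c f (fun _ => 0) x) ^ 2) := by
  have hγ : Continuous fun q => gam lam (A q) (b q) (c q) := by
    unfold gam
    refine Continuous.div ?_ ?_ ?_
    · exact (Continuous.matrix_trace hAc).add (hcc.div_const _)
    · simp only [fip]
      refine Continuous.add (Continuous.add ?_ ?_) ?_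
      · exact Continuous.matrix_trace ((Continuous.matrix_transpose hAc).matrix_mul hAc)
      · fun_prop
      · fun_prop
    · intro q
      have h1 : 0 ≤ fip (A q) (A q) := by
        rw [aux_fip]; exact Finset.sum_nonneg fun i _ => Finset.sum_nonneg fun j _ =>
          mul_self_nonneg _
      have h2 : 0 ≤ ∑ i, b q i ^ 2 := Finset.sum_nonneg fun i _ => sq_nonneg _
      have h3 := hcpos q
      positivity
  have hF0 : ∀ y, Fgam lam A b c f (fun _ => 0) y
      = ⨅ α : 𝒜, ⨆ β : ℬ, -(gam lam (A (y, α, β)) (b (y, α, β)) (c (y, α, β)) * f (y, α, β)) := by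
    intro y
    have hp : ∀ i : Fin n, pd i (fun _ => (0:ℝ)) = fun _ => 0 := by
      intro i; funext x; simp [pd]
    have hh : hess (fun _ : Fin n → ℝ => (0:ℝ)) y = 0 := by
      ext i j
      simp only [hess, Matrix.of_apply, hp, Matrix.zero_apply]
    unfold Fgam
    simp [hp, hh, fip]
  have hF0c : Continuous (Fgam lam A b c f (fun _ => 0)) := by
    rw [funext hF0]
    exact aux_infsup_cont (fun q => -(gam lam (A q) (b q) (c q) * f q)) (hγ.mul hfc).neg
  obtain ⟨hδ0, hδ1⟩ := hδ
  set κ := Real.sqrt (1 - δ) with hκ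
  have hκ0 : 0 < κ := Real.sqrt_pos.2 (by linarith)
  have hκ2 : κ ^ 2 = 1 - δ := Real.sq_sqrt (by linarith)
  have hκ1 : κ < 1 := by nlinarith
  have hpt : ∀ y, (Llam lam u y + Fgam lam A b c f (fun _ => 0) y) ^ 2 ≤ κ ^ 2 *
      (∑ i, ∑ j, hess u y i j ^ 2 + 2 * lam * ∑ i, pd i u y ^ 2 + lam ^ 2 * u y ^ 2) := by
    intro y
    set Q := ∑ i, ∑ j, hess u y i j ^ 2 + 2 * lam * ∑ i, pd i u y ^ 2 + lam ^ 2 * u y ^ 2 with hQ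
    have hQ0 : 0 ≤ Q := by
      have h1 : 0 ≤ ∑ i, ∑ j, hess u y i j ^ 2 := Finset.sum_nonneg fun i _ =>
        Finset.sum_nonneg fun j _ => sq_nonneg _
      have h2 : 0 ≤ ∑ i, pd i u y ^ 2 := Finset.sum_nonneg fun i _ => sq_nonneg _
      positivity
    let G : 𝒜 × ℬ → ℝ := fun q => gam lam (A (y, q)) (b (y, q)) (c (y, q)) *
      (-(fip (A (y, q)) (hess u y)) - (∑ i, b (y, q) i * pd i u y)
        + c (y, q) * u y - f (y, q))
    let G0 : 𝒜 × ℬ → ℝ := fun q => -(gam lam (A (y, q)) (b (y, q)) (c (y, q)) * f (y, q))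
    have hi : Continuous fun q : 𝒜 × ℬ => (y, q) := by fun_prop
    have hG : Continuous G := by
      have h1 := hγ.comp hi
      have h2 := hAc.comp hi
      have h3 := hbc.comp hi
      have h4 := hcc.comp hi
      have h5 := hfc.comp hi
      have h6 : Continuous fun q : 𝒜 × ℬ => fip (A (y, q)) (hess u y) := by
        unfold fip
        exact Continuous.matrix_trace ((Continuous.matrix_transpose h2).matrix_mul continuous_const)
      simp only [Function.comp_def] at h1 h3 h4 h5
      refine h1.mul (((h6.neg.sub ?_).add (h4.mul continuous_const)).sub h5)
      fun_prop
    have hG0 : Continuous G0 := ((hγ.mul hfc).neg).comp hi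
    have hd : ∀ q, |G q - G0 q - Llam lam u y| ≤ κ * Real.sqrt Q := by
      intro q
      refine abs_le_of_sq_le_sq ?_ (by positivity)
      rw [mul_pow, Real.sq_sqrt hQ0, hκ2]
      refine le_of_eq_of_le ?_ (aux_point lam δ hlam hδ0 (A (y, q)) (b (y, q)) (c (y, q))
        (hcpos _) (hCordes _) (hess u y) (fun i => pd i u y) (u y))
      congr 1
      simp only [G, G0, Llam, hess, Matrix.of_apply]
      ring
    have h1 := aux_infsup_le G G0 hG hG0 (Llam lam u y + κ * Real.sqrt Q)
      (fun q => by have := (abs_le.1 (hd q)).2; linarith)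
    have h2 := aux_infsup_le G0 G hG0 hG (-Llam lam u y + κ * Real.sqrt Q)
      (fun q => by have := (abs_le.1 (hd q)).1; linarith)
    have eG : (⨅ α, ⨆ β, G (α, β)) = 0 := hsol y
    have eG0 : (⨅ α, ⨆ β, G0 (α, β)) = Fgam lam A b c f (fun _ => 0) y := (hF0 y).symm
    rw [eG, eG0] at h1 h2
    have : |Llam lam u y + Fgam lam A b c f (fun _ => 0) y| ≤ κ * Real.sqrt Q :=
      abs_le.2 ⟨by linarith, by linarith⟩
    calc _ = |Llam lam u y + Fgam lam A b c f (fun _ => 0) y| ^ 2 := (sq_abs _).symm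
      _ ≤ (κ * Real.sqrt Q) ^ 2 := by gcongr
      _ = _ := by rw [mul_pow, Real.sq_sqrt hQ0]
  have s1 := fun i => aux_pd_smooth i hu
  have c0 := hu.continuous
  have c1 := fun i => (s1 i).continuous
  have c2 := fun i j => (aux_pd_smooth i (s1 j)).continuous
  have cL : Continuous (Llam lam u) := by unfold Llam; fun_prop
  have cQ : Continuous fun x => (∑ i, ∑ j, hess u x i j ^ 2 + 2 * lam * ∑ i, pd i u x ^ 2
        + lam ^ 2 * u x ^ 2) := by
    simp only [hess, Matrix.of_apply]; fun_prop
  have hk1 : 0 < 1 - κ := by linarith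
  have hpt2 : ∀ y, (Llam lam u y) ^ 2 ≤ κ * (∑ i, ∑ j, hess u y i j ^ 2
      + 2 * lam * ∑ i, pd i u y ^ 2 + lam ^ 2 * u y ^ 2)
      + (1 - κ)⁻¹ * (Fgam lam A b c f (fun _ => 0) y) ^ 2 := by
    intro y
    have h := hpt y
    generalize (∑ i, ∑ j, hess u y i j ^ 2
      + 2 * lam * ∑ i, pd i u y ^ 2 + lam ^ 2 * u y ^ 2) = Q at h
    generalize Llam lam u y = L at h
    generalize Fgam lam A b c f (fun _ => 0) y = F at h
    have h' : κ⁻¹ * (L + F) ^ 2 ≤ κ * Q := by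
      rw [inv_mul_eq_div, div_le_iff₀ hκ0]; linarith
    have h'' : L ^ 2 ≤ κ⁻¹ * (L + F) ^ 2 + (1 - κ)⁻¹ * F ^ 2 := by
      have : κ⁻¹ * (L + F) ^ 2 + (1 - κ)⁻¹ * F ^ 2 - L ^ 2
        = ((1 - κ) * (L + F) + κ * F) ^ 2 / (κ * (1 - κ)) := by
        field_simp
        ring
      have h0 : 0 ≤ ((1 - κ) * (L + F) + κ * F) ^ 2 / (κ * (1 - κ)) := by positivity
      linarith
    linarith
  have hint : ∫ x in Set.Icc (0 : Fin n → ℝ) 1, (Llam lam u x) ^ 2 ≤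
      ∫ x in Set.Icc (0 : Fin n → ℝ) 1, (κ * (∑ i, ∑ j, hess u x i j ^ 2
      + 2 * lam * ∑ i, pd i u x ^ 2 + lam ^ 2 * u x ^ 2)
      + (1 - κ)⁻¹ * (Fgam lam A b c f (fun _ => 0) x) ^ 2) :=
    setIntegral_mono (aux_int (by fun_prop)) (aux_int (by fun_prop)) hpt2
  rw [integral_add (aux_int (by fun_prop)) (aux_int (by fun_prop)),
    integral_const_mul, integral_const_mul, aux_ident lam hu hup] at hint
  rw [← Real.sqrt_sq (inv_pos.2 hk1).le, ← Real.sqrt_mul (sq_nonneg _)]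
  refine Real.sqrt_le_sqrt ?_
  rw [inv_pow, inv_mul_eq_div, le_div_iff₀ (by positivity)]
  rw [inv_mul_eq_div] at hint
  have h3 := sub_le_iff_le_add'.2 hint
  rw [le_div_iff₀ hk1] at h3
  linarith
end
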